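/- Let n, m be positive integers and r, s natural numbers with s even, s ≤ r ≤ m, and 2r − s ≤ 2n. Then there exist a complex (2n)×m matrix x and a complex m×(2n) matrix y such that rank(x) = r, rank(xᵀ·J·x) = s, y·x = 0, (x·y)ᵀ·J = J·(x·y), and rank(y) = min(2n − r, m − r + 2·⌊(r−s)/2⌋). (The upper bound on the rank of elements of the conormal space to the orbit O_{rs} is attained.) -/

import Mathlib

open Matrix

/-- The standard symplectic matrix `J = [[0, 1ₙ], [-1ₙ, 0]]`. -/
def symJ (n : ℕ) : Matrix (Fin n ⊕ Fin n) (Fin n ⊕ Fin n) ℂ :=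
  Matrix.fromBlocks 0 1 (-1) 0

lemma symJ_transpose (n : ℕ) : (symJ n)ᵀ = -symJ n := by
  simp [symJ, fromBlocks_transpose, fromBlocks_neg]

lemma symJ_mul_symJ (n : ℕ) : symJ n * symJ n = -1 := by
  simp [symJ, fromBlocks_multiply, ← fromBlocks_one, fromBlocks_neg]

lemma isUnit_symJ (n : ℕ) : IsUnit (symJ n) :=
  IsUnit.of_mul_eq_one (-symJ n) (by simp [symJ_mul_symJ])

lemma rank_symJ (n : ℕ) : (symJ n).rank = 2 * n := by
  rw [rank_of_isUnit _ (isUnit_symJ n)]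
  simp [two_mul]

section SelectionMatrix

variable {ι κ l : Type*} [DecidableEq ι]

/-- The matrix whose `k`-th column is the standard basis vector indexed by `f k`. -/
def selectionMatrix (f : κ → ι) : Matrix ι κ ℂ :=
  (1 : Matrix ι ι ℂ).submatrix id f

lemma selectionMatrix_transpose_mul [Fintype ι] (f : κ → ι) (M : Matrix ι l ℂ) :
    (selectionMatrix f)ᵀ * M = M.submatrix f id := by
  ext i j
  simp [selectionMatrix, mul_apply, one_apply]

lemma mul_selectionMatrix [Fintype ι] (M : Matrix l ι ℂ) (f : κ → ι) :
    M * selectionMatrix f = M.submatrix id f := by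
  ext i j
  simp [selectionMatrix, mul_apply, one_apply]

lemma selectionMatrix_mul_selectionMatrix [Fintype κ] [DecidableEq κ] (f : κ → ι) (g : l → κ) :
    selectionMatrix f * selectionMatrix g = selectionMatrix (f ∘ g) := by
  rw [mul_selectionMatrix]
  rfl

lemma selectionMatrix_transpose_mul_self [Fintype ι] [DecidableEq κ] {f : κ → ι}
    (hf : Function.Injective f) :
    (selectionMatrix f)ᵀ * selectionMatrix f = 1 := by
  rw [selectionMatrix_transpose_mul]
  exact submatrix_one f hf

lemma selectionMatrix_transpose_mul_eq_zero [Fintype ι] {f : κ → ι} {g : l → ι}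
    (h : ∀ i j, f i ≠ g j) : (selectionMatrix f)ᵀ * selectionMatrix g = 0 := by
  rw [selectionMatrix_transpose_mul]
  ext i j
  simp [selectionMatrix, h i j]

lemma rank_selectionMatrix_mul_mul_transpose [Fintype ι] [Fintype κ] [DecidableEq κ]
    {ι' κ' : Type*} [Fintype ι'] [DecidableEq ι'] [Fintype κ'] [DecidableEq κ']
    {g : κ → ι} (hg : Function.Injective g)
    {f : κ' → ι'} (hf : Function.Injective f) (D : Matrix κ κ' ℂ) :
    (selectionMatrix g * D * (selectionMatrix f)ᵀ).rank = D.rank := by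
  apply le_antisymm
  · exact (rank_mul_le_left _ _).trans (rank_mul_le_right _ _)
  · have h : D = (selectionMatrix g)ᵀ *
        ((selectionMatrix g * D * (selectionMatrix f)ᵀ) * selectionMatrix f) := by
      rw [Matrix.mul_assoc _ _ (selectionMatrix f), selectionMatrix_transpose_mul_self hf,
        Matrix.mul_one, ← Matrix.mul_assoc, selectionMatrix_transpose_mul_self hg,
        Matrix.one_mul]
    conv_lhs => rw [h]
    exact (rank_mul_le_right _ _).trans (rank_mul_le_left _ _)

end SelectionMatrix

lemma symJ_mul_selectionMatrix_inl {κ : Type*} {n : ℕ} (u : κ → Fin n) :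
    symJ n * selectionMatrix (Sum.inl ∘ u : κ → Fin n ⊕ Fin n) =
      -selectionMatrix (Sum.inr ∘ u : κ → Fin n ⊕ Fin n) := by
  rw [mul_selectionMatrix]
  ext (i | i) j <;> simp [symJ, selectionMatrix, one_apply]

/-- Indices of a basis of a subspace of dimension `2 * a + t` whose radical has dimension `t`. -/
def basisIndex {a t n : ℕ} (h : a + t ≤ n) : (Fin a ⊕ Fin a) ⊕ Fin t → Fin n ⊕ Fin n
  | .inl (.inl i) => .inl ⟨i, by omega⟩
  | .inl (.inr i) => .inr ⟨i, by omega⟩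
  | .inr k => .inl ⟨a + k, by omega⟩

/-- Indices of the basis vectors dual to the radical of the subspace given by `basisIndex`. -/
def dualIndex {a t n : ℕ} (h : a + t ≤ n) (k : Fin t) : Fin n := ⟨a + k, by omega⟩

lemma injective_elim_basisIndex_dualIndex {a t n : ℕ} (h : a + t ≤ n) :
    Function.Injective (Sum.elim (basisIndex h) (Sum.inr ∘ dualIndex h)) := by
  rintro (((i | i) | i) | i) (((j | j) | j) | j) hij <;>
    simp [basisIndex, dualIndex, Fin.ext_iff] at hij ⊢ <;> omega

lemma symJ_submatrix_basisIndex {a t n : ℕ} (h : a + t ≤ n) :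
    (symJ n).submatrix (basisIndex h) (basisIndex h) =
      selectionMatrix (Sum.inl : _ → (Fin a ⊕ Fin a) ⊕ Fin t) * symJ a *
        (selectionMatrix (Sum.inl : _ → (Fin a ⊕ Fin a) ⊕ Fin t))ᵀ := by
  ext ((i | i) | i) ((j | j) | j) <;>
    simp [symJ, basisIndex, selectionMatrix, mul_apply, one_apply, Fin.ext_iff] <;> omega

/-- An injection into a finite type extends to an injection of a larger type. -/
lemma exists_injective_elim {κ ι : Type*} [Fintype κ] [Fintype ι] {f : κ → ι}
    (hf : Function.Injective f) {d : ℕ} (hd : Fintype.card κ + d ≤ Fintype.card ι) :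
    ∃ g : Fin d → ι, Function.Injective (Sum.elim f g) := by
  classical
  have hc : Fintype.card (Fin d) ≤ Fintype.card ↥(Set.range f)ᶜ := by
    rw [Fintype.card_compl_set, Set.card_range_of_injective hf, Fintype.card_fin]
    omega
  obtain ⟨e⟩ := Function.Embedding.nonempty_of_card_le hc
  refine ⟨fun i => e i, hf.sumElim (Subtype.val_injective.comp e.injective) ?_⟩
  intro i j hij
  exact (e j).2 ⟨i, hij⟩

/-- The rank bound for elements of the conormal space to `O_{rs}` is attained. -/
theorem conormal_rank_bound_attained (n m : ℕ) (hn : 0 < n) (hm : 0 < m)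
    (r s : ℕ) (hs : Even s) (hsr : s ≤ r) (hrm : r ≤ m) (hrn : 2 * r - s ≤ 2 * n) :
    ∃ (x : Matrix (Fin n ⊕ Fin n) (Fin m) ℂ)
      (y : Matrix (Fin m) (Fin n ⊕ Fin n) ℂ),
      x.rank = r ∧ (xᵀ * symJ n * x).rank = s ∧
      y * x = 0 ∧ (x * y)ᵀ * symJ n = symJ n * (x * y) ∧
      y.rank = min (2 * n - r) (m - r + 2 * ((r - s) / 2)) := by
  obtain ⟨a, rfl⟩ := hs
  obtain ⟨t, rfl⟩ := Nat.exists_eq_add_of_le hsr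
  have h : a + t ≤ n := by omega
  obtain ⟨q, hq⟩ : ∃ q, q = t / 2 := ⟨_, rfl⟩
  obtain ⟨d, hd⟩ : ∃ d, d = min (2 * n - (a + a + t) - 2 * q) (m - (a + a + t)) := ⟨_, rfl⟩
  obtain ⟨j⟩ : Nonempty (Fin q ⊕ Fin q ↪ Fin t) :=
    Function.Embedding.nonempty_of_card_le (by simp; omega)
  obtain ⟨g⟩ : Nonempty (((Fin a ⊕ Fin a) ⊕ Fin t) ⊕ Fin d ↪ Fin m) :=
    Function.Embedding.nonempty_of_card_le (by simp; omega)
  set f := basisIndex h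
  set u : Fin q ⊕ Fin q → Fin n := dualIndex h ∘ j
  have hfu : Function.Injective (Sum.elim f (Sum.inr ∘ u)) := by
    convert (injective_elim_basisIndex_dualIndex h).comp
      (Function.injective_id.sumMap j.injective) using 1
    ext (i | i) <;> rfl
  obtain ⟨f₂, hf₂⟩ := exists_injective_elim (d := d) hfu (by simp; omega)
  have f_inj : Function.Injective f := hfu.comp Sum.inl_injective
  set f' : (Fin q ⊕ Fin q) ⊕ Fin d → Fin n ⊕ Fin n := Sum.elim (Sum.inr ∘ u) f₂
  have f'_inj : Function.Injective f' := by
    convert hf₂.comp (Sum.inr_injective.sumMap Function.injective_id) using 1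
    ext (i | i) <;> rfl
  have f'_ne : ∀ i k, f' i ≠ f k := by
    rintro (i | i) k hik
    · exact Sum.inr_ne_inl (Sum.inl_injective
        (@hf₂ (.inl (.inr i)) (.inl (.inl k)) hik))
    · exact Sum.inr_ne_inl (@hf₂ (.inr i) (.inl (.inl k)) hik)
  set g₁ : (Fin a ⊕ Fin a) ⊕ Fin t → Fin m := g ∘ Sum.inl with hg₁
  have g₁_inj : Function.Injective g₁ := g.injective.comp Sum.inl_injective
  set g' : (Fin q ⊕ Fin q) ⊕ Fin d → Fin m := g ∘ Sum.map (Sum.inr ∘ j) id with hg'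
  have g'_inj : Function.Injective g' :=
    g.injective.comp ((Sum.inr_injective.comp j.injective).sumMap Function.injective_id)
  set D : Matrix ((Fin q ⊕ Fin q) ⊕ Fin d) ((Fin q ⊕ Fin q) ⊕ Fin d) ℂ :=
    fromBlocks (symJ q) 0 0 1 with hD
  have D_unit : IsUnit D :=
    IsUnit.of_mul_eq_one (fromBlocks (-symJ q) 0 0 1)
      (by simp [hD, fromBlocks_multiply, symJ_mul_symJ])
  let eu : Fin q ⊕ Fin q → Fin n ⊕ Fin n := Sum.inl ∘ u
  let fu : Fin q ⊕ Fin q → Fin n ⊕ Fin n := Sum.inr ∘ u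
  let p : Fin q ⊕ Fin q → (Fin q ⊕ Fin q) ⊕ Fin d := Sum.inl
  let k : Fin q ⊕ Fin q → (Fin a ⊕ Fin a) ⊕ Fin t := Sum.inr ∘ j
  have hgg : (selectionMatrix g₁)ᵀ * selectionMatrix g' =
      selectionMatrix k * (selectionMatrix p)ᵀ := by
    rw [selectionMatrix_transpose_mul]
    ext i (l | l) <;>
      simp [p, k, selectionMatrix, hg₁, hg', mul_apply, one_apply]
  have hDl : (selectionMatrix p)ᵀ * D = symJ q * (selectionMatrix p)ᵀ := by
    rw [selectionMatrix_transpose_mul]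
    ext i (l | l) <;> simp [p, selectionMatrix, hD, mul_apply, one_apply]
  have hxy : selectionMatrix f * (selectionMatrix g₁)ᵀ *
      (selectionMatrix g' * D * (selectionMatrix f')ᵀ) =
      selectionMatrix eu * symJ q * (selectionMatrix fu)ᵀ := by
    calc _ = selectionMatrix f * ((selectionMatrix g₁)ᵀ * selectionMatrix g') * D *
          (selectionMatrix f')ᵀ := by simp only [Matrix.mul_assoc]
      _ = (selectionMatrix f * selectionMatrix k) *
          ((selectionMatrix p)ᵀ * D) * (selectionMatrix f')ᵀ := by
        rw [hgg]; simp only [Matrix.mul_assoc]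
      _ = (selectionMatrix f * selectionMatrix k) * symJ q *
          (selectionMatrix f' * selectionMatrix p)ᵀ := by
        rw [hDl, transpose_mul]; simp only [Matrix.mul_assoc]
      _ = _ := by
        rw [selectionMatrix_mul_selectionMatrix, selectionMatrix_mul_selectionMatrix]
        rfl
  refine ⟨selectionMatrix f * (selectionMatrix g₁)ᵀ,
    selectionMatrix g' * D * (selectionMatrix f')ᵀ, ?_, ?_, ?_, ?_, ?_⟩
  · have := rank_selectionMatrix_mul_mul_transpose f_inj g₁_inj 1
    rw [Matrix.mul_one] at this
    rw [this, rank_one]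
    simp
  · have : (selectionMatrix f * (selectionMatrix g₁)ᵀ)ᵀ * symJ n *
        (selectionMatrix f * (selectionMatrix g₁)ᵀ) =
        selectionMatrix g₁ * (symJ n).submatrix f f * (selectionMatrix g₁)ᵀ := by
      have hJ : (symJ n).submatrix f f =
          (selectionMatrix f)ᵀ * (symJ n * selectionMatrix f) := by
        rw [selectionMatrix_transpose_mul, mul_selectionMatrix]
        rfl
      rw [hJ, transpose_mul, transpose_transpose]
      simp only [Matrix.mul_assoc]
    rw [this, rank_selectionMatrix_mul_mul_transpose g₁_inj g₁_inj,
      symJ_submatrix_basisIndex,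
      rank_selectionMatrix_mul_mul_transpose Sum.inl_injective Sum.inl_injective,
      rank_symJ, two_mul]
  · rw [Matrix.mul_assoc, ← Matrix.mul_assoc (selectionMatrix f')ᵀ,
      selectionMatrix_transpose_mul_eq_zero f'_ne]
    simp
  · have hJ : (selectionMatrix eu)ᵀ * symJ n =
        (selectionMatrix fu)ᵀ := by
      have := congrArg transpose (symJ_mul_selectionMatrix_inl u)
      simpa [transpose_mul, symJ_transpose] using this
    rw [hxy, Matrix.mul_assoc _ (symJ q), ← Matrix.mul_assoc (symJ n),
      symJ_mul_selectionMatrix_inl, transpose_mul, transpose_mul, Matrix.mul_assoc, hJ,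
      symJ_transpose]
    simp [Matrix.mul_assoc, fu]
  · rw [rank_selectionMatrix_mul_mul_transpose g'_inj f'_inj, rank_of_isUnit _ D_unit]
    simp
    omega
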